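/- The Bessel function J_0 is negative on the open interval between its first two positive zeros r₁ and r₂; in particular J_0(3.8) < 0 and J_0 has no zero in, e.g., the interval [3.7, 3.9] ⊂ (r₁, r₂). -/

import Mathlib

open MeasureTheory Real

/-- The Bessel function `J_0(r) = (1/2π) ∫₀^{2π} exp(i r sin θ) dθ`. -/
noncomputable def besselJ0 (r : ℝ) : ℝ :=
  ((1 / (2 * (Real.pi : ℂ))) *
    ∫ θ in (0:ℝ)..(2 * Real.pi),
      Complex.exp (Complex.I * (r : ℂ) * (Real.sin θ : ℂ))).re

/-- The Taylor polynomials of `cos` and `sin` at `0` alternately bound the functions from above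
and from below on `[0, ∞)`. -/
lemma alternating_taylor_bounds (n : ℕ) :
    (∀ x : ℝ, 0 ≤ x → 0 ≤ (-1 : ℝ) ^ n *
      ((∑ k ∈ Finset.range (n + 1), (-1 : ℝ) ^ k * x ^ (2 * k) / (2 * k).factorial) - cos x)) ∧
    (∀ x : ℝ, 0 ≤ x → 0 ≤ (-1 : ℝ) ^ n *
      ((∑ k ∈ Finset.range (n + 1), (-1 : ℝ) ^ k * x ^ (2 * k + 1) / (2 * k + 1).factorial)
        - sin x)) := by
  have nonneg_of_deriv : ∀ f f' : ℝ → ℝ, (∀ x, HasDerivAt f (f' x) x) → f 0 = 0 →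
      (∀ x, 0 ≤ x → 0 ≤ f' x) → ∀ x, 0 ≤ x → 0 ≤ f x := by
    intro f f' hf h0 hf' x hx
    have hmono : MonotoneOn f (Set.Ici 0) := by
      refine monotoneOn_of_deriv_nonneg (convex_Ici 0)
        (fun y _ => (hf y).continuousAt.continuousWithinAt)
        (fun y _ => (hf y).differentiableAt.differentiableWithinAt) fun y hy => ?_
      rw [(hf y).deriv]
      exact hf' y (interior_subset hy)
    simpa [h0] using hmono Set.self_mem_Ici hx hx
  have sin_of_cos : ∀ n : ℕ, (∀ x : ℝ, 0 ≤ x → 0 ≤ (-1 : ℝ) ^ n *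
      ((∑ k ∈ Finset.range (n + 1), (-1 : ℝ) ^ k * x ^ (2 * k) / (2 * k).factorial) - cos x)) →
      ∀ x : ℝ, 0 ≤ x → 0 ≤ (-1 : ℝ) ^ n *
      ((∑ k ∈ Finset.range (n + 1), (-1 : ℝ) ^ k * x ^ (2 * k + 1) / (2 * k + 1).factorial)
        - sin x) := by
    intro n h
    refine nonneg_of_deriv _ _ (fun x => ?_) (by simp) h
    refine HasDerivAt.const_mul _ (HasDerivAt.sub (HasDerivAt.fun_sum fun k _ => ?_)
      (hasDerivAt_sin x))
    refine (((hasDerivAt_pow (2 * k + 1) x).const_mul ((-1 : ℝ) ^ k)).div_const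
      ((2 * k + 1).factorial : ℝ)).congr_deriv ?_
    rw [Nat.factorial_succ]
    push_cast
    have : ((2 * k).factorial : ℝ) ≠ 0 := by positivity
    have : (2 * k + 1 : ℝ) ≠ 0 := by positivity
    field_simp
  induction n with
  | zero =>
    have h : ∀ x : ℝ, 0 ≤ x → 0 ≤ (-1 : ℝ) ^ 0 *
      ((∑ k ∈ Finset.range (0 + 1), (-1 : ℝ) ^ k * x ^ (2 * k) / (2 * k).factorial) - cos x) := by
      intro x _
      simpa using cos_le_one x
    exact ⟨h, sin_of_cos 0 h⟩
  | succ n ih =>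
    have h : ∀ x : ℝ, 0 ≤ x → 0 ≤ (-1 : ℝ) ^ (n + 1) *
      ((∑ k ∈ Finset.range (n + 1 + 1), (-1 : ℝ) ^ k * x ^ (2 * k) / (2 * k).factorial)
        - cos x) := by
      refine nonneg_of_deriv _ _ (fun x => ?_) ?_ ih.2
      · simp_rw [Finset.sum_range_succ' _ (n + 1), mul_zero, pow_zero]
        have hsum : HasDerivAt (fun x : ℝ => ∑ k ∈ Finset.range (n + 1),
            (-1 : ℝ) ^ (k + 1) * x ^ (2 * (k + 1)) / (2 * (k + 1)).factorial)
            (∑ k ∈ Finset.range (n + 1),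
              -((-1 : ℝ) ^ k * x ^ (2 * k + 1) / (2 * k + 1).factorial)) x := by
          refine HasDerivAt.fun_sum fun k _ => ?_
          refine (((hasDerivAt_pow (2 * (k + 1)) x).const_mul ((-1 : ℝ) ^ (k + 1))).div_const
            ((2 * (k + 1)).factorial : ℝ)).congr_deriv ?_
          rw [show 2 * (k + 1) = 2 * k + 1 + 1 by ring, Nat.factorial_succ (2 * k + 1)]
          push_cast
          have : ((2 * k + 1).factorial : ℝ) ≠ 0 := by positivity
          have : (2 * k + 1 + 1 : ℝ) ≠ 0 := by positivity
          field_simp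
          ring
        refine (((hsum.add_const _).sub (hasDerivAt_cos x)).const_mul
          ((-1 : ℝ) ^ (n + 1))).congr_deriv ?_
        rw [Finset.sum_neg_distrib]
        ring
      · simp [Finset.sum_range_succ' _ (n + 1)]
    exact ⟨h, sin_of_cos _ h⟩

lemma besselJ0_eq_integral_cos (r : ℝ) :
    besselJ0 r = 1 / π * ∫ θ in (0:ℝ)..π, cos (r * sin θ) := by
  have hint : ∀ a b : ℝ, IntervalIntegrable (fun θ => cos (r * sin θ)) volume a b :=
    fun a b => (by fun_prop : Continuous fun θ => cos (r * sin θ)).intervalIntegrable a b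
  have hre : (∫ θ in (0:ℝ)..(2 * π), Complex.exp (Complex.I * (r : ℂ) * (sin θ : ℂ))).re
      = ∫ θ in (0:ℝ)..(2 * π), cos (r * sin θ) := by
    have hc : IntervalIntegrable
        (fun θ : ℝ => Complex.exp (Complex.I * (r : ℂ) * (sin θ : ℂ))) volume 0 (2 * π) :=
      (by fun_prop : Continuous
        fun θ : ℝ => Complex.exp (Complex.I * (r : ℂ) * (sin θ : ℂ))).intervalIntegrable _ _
    have h := Complex.reCLM.intervalIntegral_comp_comm hc
    simp only [Complex.reCLM_apply] at h
    rw [← h]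
    refine intervalIntegral.integral_congr fun θ _ => ?_
    rw [← Complex.exp_ofReal_mul_I_re]
    push_cast
    ring_nf
  have hshift : ∫ θ in π..(2 * π), cos (r * sin θ) = ∫ θ in (0:ℝ)..π, cos (r * sin θ) := by
    have h := intervalIntegral.integral_comp_add_right (a := 0) (b := π)
      (fun θ => cos (r * sin θ)) π
    rw [zero_add, ← two_mul] at h
    rw [← h]
    simp [sin_add_pi]
  rw [besselJ0, show (1 / (2 * (π : ℂ))) = ((1 / (2 * π) : ℝ) : ℂ) by push_cast; rfl,
    Complex.re_ofReal_mul, hre, ← intervalIntegral.integral_add_adjacent_intervals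
      (hint 0 π) (hint π (2 * π)), hshift]
  have := pi_ne_zero
  field_simp
  ring

lemma continuous_besselJ0 : Continuous besselJ0 := by
  rw [funext besselJ0_eq_integral_cos]
  exact continuous_const.mul
    (intervalIntegral.continuous_parametric_intervalIntegral_of_continuous' (by fun_prop) _ _)

lemma besselJ0_zero : besselJ0 0 = 1 := by
  simp [besselJ0_eq_integral_cos, pi_ne_zero]

lemma strictAntiOn_besselJ0 : StrictAntiOn besselJ0 (Set.Icc 0 π) := by
  intro a ha b hb hab
  rw [besselJ0_eq_integral_cos, besselJ0_eq_integral_cos]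
  refine mul_lt_mul_of_pos_left ?_ (by positivity)
  have hlt : ∀ θ ∈ Set.Ioo 0 π, cos (b * sin θ) < cos (a * sin θ) := by
    intro θ hθ
    have hs := sin_pos_of_mem_Ioo hθ
    refine strictAntiOn_cos ⟨mul_nonneg ha.1 hs.le, ?_⟩ ⟨mul_nonneg hb.1 hs.le, ?_⟩
      (mul_lt_mul_of_pos_right hab hs)
    · nlinarith [sin_le_one θ, ha.1, ha.2]
    · nlinarith [sin_le_one θ, hb.1, hb.2]
  refine intervalIntegral.integral_lt_integral_of_continuousOn_of_le_of_exists_lt pi_pos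
    (by fun_prop) (by fun_prop) (fun θ hθ => ?_)
    ⟨π / 2, ⟨by positivity, by linarith [pi_pos]⟩, hlt _ ⟨by positivity, by linarith [pi_pos]⟩⟩
  rcases hθ.2.eq_or_lt with rfl | h
  · simp
  · exact (hlt θ ⟨hθ.1, h⟩).le

/-- The partial sums of the power series of `J_0` alternately bound it from above and below. -/
lemma besselJ0_alternating_bound (n : ℕ) {r : ℝ} (hr : 0 ≤ r) :
    0 ≤ (-1 : ℝ) ^ n * ((∑ k ∈ Finset.range (n + 1), (-1 : ℝ) ^ k * r ^ (2 * k) /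
      (2 * k).factorial * ∏ i ∈ Finset.range k, (2 * (i : ℝ) + 1) / (2 * i + 2))
        - besselJ0 r) := by
  have hmean : ∑ k ∈ Finset.range (n + 1), (-1 : ℝ) ^ k * r ^ (2 * k) /
      (2 * k).factorial * ∏ i ∈ Finset.range k, (2 * (i : ℝ) + 1) / (2 * i + 2)
      = 1 / π * ∫ θ in (0:ℝ)..π, ∑ k ∈ Finset.range (n + 1),
        (-1 : ℝ) ^ k * (r * sin θ) ^ (2 * k) / (2 * k).factorial := by
    rw [intervalIntegral.integral_finsetSum
      fun k _ => Continuous.intervalIntegrable (by fun_prop) _ _, Finset.mul_sum]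
    refine Finset.sum_congr rfl fun k _ => ?_
    have h : ∀ θ, (-1 : ℝ) ^ k * (r * sin θ) ^ (2 * k) / (2 * k).factorial
        = (-1 : ℝ) ^ k * r ^ (2 * k) / (2 * k).factorial * sin θ ^ (2 * k) := by
      intro θ
      rw [mul_pow]
      ring
    simp_rw [h]
    rw [intervalIntegral.integral_const_mul, integral_sin_pow_even]
    have := pi_ne_zero
    field_simp
  rw [hmean, besselJ0_eq_integral_cos, ← mul_sub, ← intervalIntegral.integral_sub
    (Continuous.intervalIntegrable (by fun_prop) _ _)
    (Continuous.intervalIntegrable (by fun_prop) _ _), mul_left_comm,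
    ← intervalIntegral.integral_const_mul]
  refine mul_nonneg (by positivity) (intervalIntegral.integral_nonneg pi_pos.le fun θ hθ => ?_)
  exact (alternating_taylor_bounds n).1 _ (mul_nonneg hr (sin_nonneg_of_mem_Icc hθ))

lemma besselJ0_neg_of_mem_Icc {r : ℝ} (hr : r ∈ Set.Icc (3 : ℝ) 3.9) : besselJ0 r < 0 := by
  have h := besselJ0_alternating_bound 4 (by linarith [hr.1] : 0 ≤ r)
  norm_num [Finset.sum_range_succ, Finset.prod_range_succ, Nat.factorial] at h
  obtain ⟨t, ht⟩ : ∃ t, t = r ^ 2 := ⟨_, rfl⟩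
  have ht1 : 9 ≤ t := by nlinarith [hr.1]
  have ht2 : t ≤ 16 := by nlinarith [hr.1, hr.2]
  have hpoly : 1 - t / 4 + t ^ 2 / 64 - t ^ 3 / 2304 + t ^ 4 / 147456 < 0 := by
    nlinarith [mul_nonneg (sub_nonneg.2 ht1) (sub_nonneg.2 ht2),
      mul_nonneg (mul_nonneg (sub_nonneg.2 ht1) (sub_nonneg.2 ht2)) (sq_nonneg t),
      mul_nonneg (mul_nonneg (sub_nonneg.2 ht1) (sub_nonneg.2 ht2)) (sub_nonneg.2 ht1)]
  rw [ht] at hpoly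
  nlinarith

lemma besselJ0_six_pos : 0 < besselJ0 6 := by
  have h := besselJ0_alternating_bound 7 (by norm_num : (0 : ℝ) ≤ 6)
  norm_num [Finset.sum_range_succ, Finset.prod_range_succ, Nat.factorial] at h
  linarith

/-- `J_0` has a first and a second positive zero `r₁ < r₂`, is negative on `(r₁, r₂)`,
`[3.7, 3.9] ⊆ (r₁, r₂)`; in particular `J_0(3.8) < 0` and `J_0` has no zero on
`[3.7, 3.9]`. -/
theorem besselJ0_negative_between_first_two_zeros :
    ∃ r₁ r₂ : ℝ, 0 < r₁ ∧ r₁ < r₂ ∧ besselJ0 r₁ = 0 ∧ besselJ0 r₂ = 0 ∧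
      (∀ s, 0 < s → s < r₁ → besselJ0 s ≠ 0) ∧
      (∀ s, r₁ < s → s < r₂ → besselJ0 s ≠ 0) ∧
      (∀ s ∈ Set.Ioo r₁ r₂, besselJ0 s < 0) ∧
      Set.Icc (3.7 : ℝ) 3.9 ⊆ Set.Ioo r₁ r₂ ∧
      besselJ0 3.8 < 0 ∧
      (∀ s ∈ Set.Icc (3.7 : ℝ) 3.9, besselJ0 s ≠ 0) := by
  have hneg := @besselJ0_neg_of_mem_Icc
  have hpi := pi_gt_three
  obtain ⟨r₁, ⟨h0, h3⟩, hz₁⟩ : (0 : ℝ) ∈ besselJ0 '' Set.Ioo 0 3 :=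
    intermediate_value_Ioo' (by norm_num) continuous_besselJ0.continuousOn
      ⟨hneg ⟨le_rfl, by norm_num⟩, by simp [besselJ0_zero]⟩
  obtain ⟨r₂, ⟨⟨h39, h6⟩, hz₂⟩, hleast⟩ :
      ∃ r₂, IsLeast (Set.Icc (3.9 : ℝ) 6 ∩ besselJ0 ⁻¹' {0}) r₂ := by
    refine (isCompact_Icc.inter_right
      (isClosed_singleton.preimage continuous_besselJ0)).exists_isLeast ?_
    obtain ⟨s, hs, hs0⟩ := intermediate_value_Icc (by norm_num : (3.9 : ℝ) ≤ 6)
      continuous_besselJ0.continuousOn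
      ⟨(hneg ⟨by norm_num, le_rfl⟩).le, besselJ0_six_pos.le⟩
    exact ⟨s, hs, hs0⟩
  have hlt : 3.9 < r₂ := h39.lt_of_ne <| by
    rintro rfl
    exact (hneg ⟨by norm_num, le_rfl⟩).ne hz₂
  have hneg' : ∀ s ∈ Set.Ioo r₁ r₂, besselJ0 s < 0 := by
    rintro s ⟨hs₁, hs₂⟩
    rcases le_or_gt s 3 with hs3 | hs3
    · rw [← hz₁]
      exact strictAntiOn_besselJ0 ⟨h0.le, by linarith⟩ ⟨by linarith, by linarith⟩ hs₁
    rcases le_or_gt s 3.9 with hs39 | hs39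
    · exact hneg ⟨hs3.le, hs39⟩
    by_contra! hs
    obtain ⟨u, hu, hu0⟩ := intermediate_value_Icc hs39.le continuous_besselJ0.continuousOn
      ⟨(hneg ⟨by norm_num, le_rfl⟩).le, hs⟩
    linarith [hleast ⟨⟨hu.1, by linarith [hu.2]⟩, hu0⟩, hu.2]
  have hsub : Set.Icc (3.7 : ℝ) 3.9 ⊆ Set.Ioo r₁ r₂ := fun s hs =>
    ⟨by norm_num at hs; linarith, by linarith [hs.2]⟩
  refine ⟨r₁, r₂, h0, by norm_num at hlt; linarith, hz₁, hz₂, fun s hs0 hs => ?_,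
    fun s hs₁ hs₂ => (hneg' s ⟨hs₁, hs₂⟩).ne, hneg', hsub,
    hneg' _ (hsub ⟨by norm_num, by norm_num⟩), fun s hs => (hneg' s (hsub hs)).ne⟩
  have := strictAntiOn_besselJ0 ⟨hs0.le, by linarith⟩ ⟨h0.le, by linarith⟩ hs
  rw [hz₁] at this
  exact this.ne'
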